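/- Let w be an odd positive integer, ε ∈ {+1,−1}, p ∈ W_{w−1}^{ε}, and q ∈ W_{w+1}^{−ε}. Put R(X,Y) := X·p(X+Y,X) + (∂/∂Y)[q(X+Y,X)], where (∂/∂Y)[q(X+Y,X)] denotes the partial derivative with respect to Y of the polynomial obtained by substituting (X+Y,X) into q. If R(X,Y) + ε·R(Y,X) − ε·R(−X,Y) − R(Y,−X) = 0, then p = 0 and q is a rational multiple of X^{w+1} − Y^{w+1}. -/

import Mathlib

open MvPolynomial

/-- Substitution: `sub2 a b p` is `p(a, b)` for a bivariate polynomial `p(X,Y)`. -/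
noncomputable def sub2 (a b p : MvPolynomial (Fin 2) ℚ) : MvPolynomial (Fin 2) ℚ :=
  aeval ![a, b] p

/-- `memV w ε p` : `p ∈ V_w^ε`, i.e. `p` is homogeneous of degree `w` and
`p(-X,Y) = ε p(X,Y)`. -/
def memV (w : ℕ) (ε : ℤ) (p : MvPolynomial (Fin 2) ℚ) : Prop :=
  p.IsHomogeneous w ∧ sub2 (-X 0) (X 1) p = (ε : ℚ) • p

/-- `memW w ε p` : `p ∈ W_w^ε`, the space of period polynomials: `p ∈ V_w^ε` with
`p(X,Y) + p(-Y,X) = 0` and `p(X,Y) + p(X-Y,X) + p(-Y,X-Y) = 0`. -/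
def memW (w : ℕ) (ε : ℤ) (p : MvPolynomial (Fin 2) ℚ) : Prop :=
  memV w ε p ∧
  p + sub2 (-X 1) (X 0) p = 0 ∧
  p + sub2 (X 0 - X 1) (X 0) p + sub2 (-X 1) (X 0 - X 1) p = 0

theorem sub2_X_zero (a b : MvPolynomial (Fin 2) ℚ) : sub2 a b (X 0) = a := by simp [sub2]

theorem sub2_X_one (a b : MvPolynomial (Fin 2) ℚ) : sub2 a b (X 1) = b := by simp [sub2]

theorem sub2_C (a b : MvPolynomial (Fin 2) ℚ) (c : ℚ) : sub2 a b (C c) = C c := by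
  simp [sub2, algebraMap_eq]

theorem sub2_zero (a b : MvPolynomial (Fin 2) ℚ) : sub2 a b 0 = 0 := map_zero _

theorem sub2_add (a b f g : MvPolynomial (Fin 2) ℚ) :
    sub2 a b (f + g) = sub2 a b f + sub2 a b g :=
  map_add _ f g

theorem sub2_neg (a b f : MvPolynomial (Fin 2) ℚ) : sub2 a b (-f) = -sub2 a b f :=
  map_neg _ f

theorem sub2_sub (a b f g : MvPolynomial (Fin 2) ℚ) :
    sub2 a b (f - g) = sub2 a b f - sub2 a b g :=
  map_sub _ f g

theorem sub2_mul (a b f g : MvPolynomial (Fin 2) ℚ) :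
    sub2 a b (f * g) = sub2 a b f * sub2 a b g :=
  map_mul _ f g

theorem sub2_pow (a b f : MvPolynomial (Fin 2) ℚ) (n : ℕ) :
    sub2 a b (f ^ n) = sub2 a b f ^ n :=
  map_pow _ f n

theorem sub2_smul (a b f : MvPolynomial (Fin 2) ℚ) (c : ℚ) :
    sub2 a b (c • f) = c • sub2 a b f :=
  map_smul _ c f

theorem sub2_sub2 (a b c d p : MvPolynomial (Fin 2) ℚ) :
    sub2 a b (sub2 c d p) = sub2 (sub2 a b c) (sub2 a b d) p := by
  unfold sub2
  induction p using MvPolynomial.induction_on with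
  | C r => simp
  | add f g hf hg => simp only [map_add, hf, hg]
  | mul_X f i hf =>
    simp only [map_mul, hf, aeval_X]
    fin_cases i <;> rfl

theorem sub2_X_X (p : MvPolynomial (Fin 2) ℚ) : sub2 (X 0) (X 1) p = p := by
  have h : (![X 0, X 1] : Fin 2 → MvPolynomial (Fin 2) ℚ) = X := by
    funext i
    fin_cases i <;> rfl
  rw [sub2, h, aeval_X_left_apply]

theorem eval_sub2 (v : Fin 2 → ℚ) (a b p : MvPolynomial (Fin 2) ℚ) :
    eval v (sub2 a b p) = eval ![eval v a, eval v b] p := by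
  unfold sub2
  induction p using MvPolynomial.induction_on with
  | C r => simp
  | add f g hf hg => simp only [map_add, hf, hg]
  | mul_X f i hf =>
    simp only [map_mul, hf, aeval_X, eval_X]
    fin_cases i <;> rfl

theorem pderiv_sub2 (i : Fin 2) (a b p : MvPolynomial (Fin 2) ℚ) :
    pderiv i (sub2 a b p) =
      sub2 a b (pderiv 0 p) * pderiv i a + sub2 a b (pderiv 1 p) * pderiv i b := by
  unfold sub2
  induction p using MvPolynomial.induction_on with
  | C r => simp [algebraMap_eq]
  | add f g hf hg => simp only [map_add, hf, hg]; ring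
  | mul_X f j hf =>
    simp only [map_mul, Derivation.leibniz, map_add, hf, aeval_X, smul_eq_mul]
    fin_cases j <;> simp [pderiv_X] <;> ring

theorem MvPolynomial.IsHomogeneous.sub2_neg_neg {n : ℕ} {p : MvPolynomial (Fin 2) ℚ}
    (hp : p.IsHomogeneous n) (a b : MvPolynomial (Fin 2) ℚ) :
    sub2 (-a) (-b) p = (-1) ^ n * sub2 a b p := by
  unfold sub2
  rw [aeval_def, aeval_def, eval₂_eq', eval₂_eq', Finset.mul_sum]
  refine Finset.sum_congr rfl fun d hd => ?_
  have h : d 0 + d 1 = n := by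
    have := hp (mem_support_iff.mp hd)
    simpa [Finsupp.weight_apply, Finsupp.sum_fintype] using this
  simp only [Fin.prod_univ_two, Matrix.cons_val_zero, Matrix.cons_val_one, ← h]
  rw [neg_pow a, neg_pow b, pow_add]
  ring

theorem MvPolynomial.IsHomogeneous.eval_zero_eq {n : ℕ} {p : MvPolynomial (Fin 2) ℚ}
    (hp : p.IsHomogeneous n) (y : ℚ) :
    eval ![0, y] p = y ^ n * eval ![0, 1] p := by
  rw [eval_eq', eval_eq', Finset.mul_sum]
  refine Finset.sum_congr rfl fun d hd => ?_
  have h : d 0 + d 1 = n := by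
    have := hp (mem_support_iff.mp hd)
    simpa [Finsupp.weight_apply, Finsupp.sum_fintype] using this
  simp only [Fin.prod_univ_two, Matrix.cons_val_zero, Matrix.cons_val_one, ← h]
  rcases Nat.eq_zero_or_pos (d 0) with h0 | h0
  · simp [h0]; ring
  · simp [h0.ne']

/-- A binary form invariant under `X ↦ X + Y` is a multiple of a power of `Y`. -/
theorem MvPolynomial.IsHomogeneous.eq_C_mul_X_pow_of_sub2_add {n : ℕ}
    {F : MvPolynomial (Fin 2) ℚ} (hF : F.IsHomogeneous n)
    (h : ∀ a b, sub2 (a + b) b F = sub2 a b F) :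
    ∃ c : ℚ, F = C c * X 1 ^ n := by
  have hshift (x y : ℚ) : eval ![x + y, y] F = eval ![x, y] F := by
    simpa [eval_sub2] using congrArg (eval ![x, y]) (h (X 0) (X 1))
  have hmul (y : ℚ) (m : ℕ) : eval ![m * y, y] F = eval ![0, y] F := by
    induction m with
    | zero => simp
    | succ m ih => rw [← ih, ← hshift (m * y)]; push_cast; rw [add_mul, one_mul]
  have hconst (x y : ℚ) (hy : y ≠ 0) : eval ![x, y] F = eval ![0, y] F := by
    let g : Polynomial ℚ := MvPolynomial.aeval ![Polynomial.X, Polynomial.C y] F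
    have hg (t : ℚ) : g.eval t = eval ![t, y] F := by
      refine RingHom.congr_fun (f := (Polynomial.evalRingHom t).comp
        (MvPolynomial.aeval ![Polynomial.X, Polynomial.C y]).toRingHom) (g := eval ![t, y]) ?_ F
      ext i
      · simp
      · fin_cases i <;> simp
    have : g = Polynomial.C (eval ![0, y] F) := by
      refine Polynomial.eq_of_infinite_eval_eq _ _ <|
        (Set.infinite_range_of_injective (f := fun m : ℕ => (m : ℚ) * y) fun m k hmk => by
          simpa [hy] using hmk).mono ?_
      rintro _ ⟨m, rfl⟩
      simp [hg, hmul]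
    rw [← hg, this, Polynomial.eval_C]
  refine ⟨eval ![0, 1] F, ?_⟩
  have hX : (X 1 : MvPolynomial (Fin 2) ℚ) ≠ 0 := X_ne_zero 1
  refine mul_left_cancel₀ hX (MvPolynomial.funext fun v => ?_)
  obtain ⟨x, y, rfl⟩ : ∃ x y, v = ![x, y] := ⟨v 0, v 1, by ext i; fin_cases i <;> rfl⟩
  by_cases hy : y = 0
  · simp [hy]
  · simp only [map_mul, map_pow, eval_X, eval_C, hconst x y hy, hF.eval_zero_eq y,
      Matrix.cons_val_one, Matrix.cons_val_zero]
    ring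

theorem pderiv_zero_X_zero : pderiv 0 (X 0 : MvPolynomial (Fin 2) ℚ) = 1 := pderiv_X_self 0

theorem pderiv_one_X_one : pderiv 1 (X 1 : MvPolynomial (Fin 2) ℚ) = 1 := pderiv_X_self 1

theorem pderiv_zero_X_one : pderiv 0 (X 1 : MvPolynomial (Fin 2) ℚ) = 0 :=
  pderiv_X_of_ne (by decide)

theorem pderiv_one_X_zero : pderiv 1 (X 0 : MvPolynomial (Fin 2) ℚ) = 0 :=
  pderiv_X_of_ne (by decide)

section Relations

variable {n : ℕ} {ε : ℤ} {p : MvPolynomial (Fin 2) ℚ}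

theorem memW.sub2_neg_left (hp : memW n ε p) (a b : MvPolynomial (Fin 2) ℚ) :
    sub2 (-a) b p = C (ε : ℚ) * sub2 a b p := by
  have h := congrArg (sub2 a b) hp.1.2
  rw [← smul_eq_C_mul]
  simpa only [sub2_sub2, sub2_neg, sub2_X_zero, sub2_X_one, sub2_smul] using h

theorem memW.sub2_neg_left_pderiv_zero (hp : memW n ε p) (a b : MvPolynomial (Fin 2) ℚ) :
    sub2 (-a) b (pderiv 0 p) = -C (ε : ℚ) * sub2 a b (pderiv 0 p) := by
  have h := congrArg (fun f => sub2 a b (pderiv 0 f)) hp.1.2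
  simp only [pderiv_sub2, map_neg, pderiv_zero_X_zero, pderiv_zero_X_one, mul_neg, mul_one,
    mul_zero, add_zero, sub2_neg, sub2_sub2, sub2_X_zero, sub2_X_one, Derivation.map_smul,
    sub2_smul] at h
  rw [neg_mul, ← smul_eq_C_mul, ← h, neg_neg]

theorem memW.sub2_neg_left_pderiv_one (hp : memW n ε p) (a b : MvPolynomial (Fin 2) ℚ) :
    sub2 (-a) b (pderiv 1 p) = C (ε : ℚ) * sub2 a b (pderiv 1 p) := by
  have h := congrArg (fun f => sub2 a b (pderiv 1 f)) hp.1.2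
  rw [← smul_eq_C_mul]
  simpa only [pderiv_sub2, map_neg, pderiv_one_X_zero, pderiv_one_X_one, mul_one, neg_zero,
    mul_zero, zero_add, sub2_neg, sub2_sub2, sub2_X_zero, sub2_X_one, Derivation.map_smul,
    sub2_smul] using h

theorem memW.add_sub2_eq_zero (hp : memW n ε p) (a b : MvPolynomial (Fin 2) ℚ) :
    sub2 a b p + sub2 (-b) a p = 0 := by
  have h := congrArg (sub2 a b) hp.2.1
  simpa only [sub2_add, sub2_sub2, sub2_neg, sub2_X_zero, sub2_X_one, sub2_zero] using h

theorem memW.pderiv_add_sub2_eq_zero (hp : memW n ε p) (a b : MvPolynomial (Fin 2) ℚ) :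
    sub2 a b (pderiv 0 p) + sub2 (-b) a (pderiv 1 p) = 0 := by
  have h := congrArg (fun f => sub2 a b (pderiv 0 f)) hp.2.1
  simpa only [pderiv_sub2, map_add, map_neg, map_zero, pderiv_zero_X_zero, pderiv_zero_X_one,
    neg_zero, mul_one, mul_zero, zero_add, sub2_add, sub2_neg, sub2_sub2, sub2_X_zero,
    sub2_X_one, sub2_zero] using h

theorem memW.period_sub2 (hp : memW n ε p) (a b : MvPolynomial (Fin 2) ℚ) :
    sub2 a b p + sub2 (a - b) a p + sub2 (-b) (a - b) p = 0 := by
  have h := congrArg (sub2 a b) hp.2.2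
  simpa only [sub2_add, sub2_sub, sub2_sub2, sub2_neg, sub2_X_zero, sub2_X_one, sub2_zero] using h

theorem memW.period_pderiv_sub2 (hp : memW n ε p) (a b : MvPolynomial (Fin 2) ℚ) :
    sub2 a b (pderiv 0 p) + (sub2 (a - b) a (pderiv 0 p) + sub2 (a - b) a (pderiv 1 p)) +
      sub2 (-b) (a - b) (pderiv 1 p) = 0 := by
  have h := congrArg (fun f => sub2 a b (pderiv 0 f)) hp.2.2
  simpa only [pderiv_sub2, map_add, map_sub, map_neg, map_zero, pderiv_zero_X_zero,
    pderiv_zero_X_one, neg_zero, sub_zero, mul_one, mul_zero, zero_add, sub2_add, sub2_sub,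
    sub2_neg, sub2_sub2, sub2_X_zero, sub2_X_one, sub2_zero] using h

end Relations

/-- With `R(a, b) = a P(a + b, a) + Q₁(a + b, a)`, the parity and period relations for `P` and for
the partial derivatives `Q₁`, `Q₂` turn the relation for `R` into the invariance of
`F(a, b) = a P(a, b) - Q₂(a, b)` under `a ↦ a + b`. -/
theorem invariant_of_relation {A : Type*} [CommRing A] [IsDomain A] [CharZero A]
    {P Q₁ Q₂ : A → A → A} {e : A} (he : e = 1 ∨ e = -1)
    (hP_neg : ∀ a b, P (-a) (-b) = P a b)
    (hP_par : ∀ a b, P (-a) b = e * P a b)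
    (hP_anti : ∀ a b, P a b + P (-b) a = 0)
    (hP_per : ∀ a b, P a b + P (a - b) a + P (-b) (a - b) = 0)
    (hQ₁_neg : ∀ a b, Q₁ (-a) (-b) = -Q₁ a b)
    (hQ₁_par : ∀ a b, Q₁ (-a) b = e * Q₁ a b)
    (hQ₂_par : ∀ a b, Q₂ (-a) b = -e * Q₂ a b)
    (hQ₁_anti : ∀ a b, Q₁ a b + Q₂ (-b) a = 0)
    (hQ₂_neg : ∀ a b, Q₂ (-a) (-b) = -Q₂ a b)
    (hQ_per : ∀ a b, Q₁ a b + (Q₁ (a - b) a + Q₂ (a - b) a) + Q₂ (-b) (a - b) = 0)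
    (hR : ∀ a b, a * P (a + b) a + Q₁ (a + b) a + e * (b * P (b + a) b + Q₁ (b + a) b)
      - e * (-a * P (-a + b) (-a) + Q₁ (-a + b) (-a)) - (b * P (b + -a) b + Q₁ (b + -a) b) = 0)
    (a b : A) :
    (b + a) * P (b + a) b - Q₂ (b + a) b = a * P a b - Q₂ a b := by
  have hRba := hR b a
  have hRab := hR a b
  have e1 := hP_neg (a - b) a
  have e2 := hP_neg (a - b) (-b)
  have e3 := hQ₁_neg (a - b) a
  have e4 := hQ₁_neg (a - b) (-b)
  have e5 := hP_per b (-a)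
  have e6 := hQ_per b (-a)
  have e7 := hP_neg b (-a)
  have e8 := hQ₁_neg b (-a)
  have e9 := hP_anti a (a + b)
  have e10 := hQ₁_anti (-(a + b)) a
  have e11 := hQ₂_neg a (a + b)
  have e12 := hP_par b a
  have e13 := hQ₁_par b a
  have e14 := hP_par (a + b) a
  have e15 := hQ₁_par (a + b) a
  have e16 := hP_anti b a
  have e17 := hP_par a b
  have e18 := hQ₁_anti b a
  have e19 := hQ₂_par a b
  simp only [neg_neg, neg_sub, neg_add_eq_sub, sub_neg_eq_add, ← sub_eq_add_neg, add_comm b a]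
    at hRab hRba e1 e2 e3 e4 e5 e6 e7 e8 e9 e10 e11 e12 e13 e14 e15 e16 e17 e18 e19 ⊢
  have he2 : e * e = 1 := by rcases he with rfl | rfl <;> ring
  have hT : b * P (a + b) b + Q₁ (a + b) b + e * (a * P (a + b) a + Q₁ (a + b) a) = 0 := by
    refine mul_left_cancel₀ (two_ne_zero (α := A)) ?_
    rw [e1, e2, e3, e4] at hRab
    linear_combination hRba + e * hRab
      - (b * P (a + b) b + Q₁ (a + b) b + a * P (a - b) a + Q₁ (a - b) a) * he2
  have hA : e * P (a + b) a = P (a + b) b + e * P b a := by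
    linear_combination -e5 - e7 + e9 + e12 - e14
  have hB : e * Q₁ (a + b) a = e * Q₁ b a - Q₁ (a + b) b - Q₂ (a + b) b := by
    linear_combination e6 - e8 + e10 - e11 + e13 - e15
  linear_combination hT - a * hA - hB - e * a * (e16 - e17) - e * (e18 - e19)
    + (a * P a b - Q₂ a b) * he2

theorem exists_X_zero_mul_sub_pderiv_eq {w : ℕ} (hw : Odd w) {ε : ℤ} (hε : ε = 1 ∨ ε = -1)
    {p q R : MvPolynomial (Fin 2) ℚ} (hp : memW (w - 1) ε p) (hq : memW (w + 1) (-ε) q)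
    (hR : R = X 0 * sub2 (X 0 + X 1) (X 0) p + pderiv 1 (sub2 (X 0 + X 1) (X 0) q))
    (h : R + (ε : ℚ) • sub2 (X 1) (X 0) R - (ε : ℚ) • sub2 (-X 0) (X 1) R
        - sub2 (X 1) (-X 0) R = 0) :
    ∃ c : ℚ, X 0 * p - pderiv 1 q = C c * X 1 ^ w := by
  have hph := hp.1.1
  have hqh : ∀ i, (pderiv i q).IsHomogeneous w := fun i => hq.1.1.pderiv
  have hF : (X 0 * p - pderiv 1 q).IsHomogeneous w := by
    refine .sub ?_ (hqh 1)
    have := (isHomogeneous_X ℚ (0 : Fin 2)).mul hph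
    rwa [Nat.add_sub_cancel' hw.pos] at this
  refine hF.eq_C_mul_X_pow_of_sub2_add fun a b => ?_
  simp only [sub2_sub, sub2_mul, sub2_X_zero]
  rw [add_comm a b]
  have hR' (a b) : sub2 a b R = a * sub2 (a + b) a p + sub2 (a + b) a (pderiv 0 q) := by
    rw [hR, pderiv_sub2]
    simp only [sub2_add, sub2_mul, sub2_sub2, sub2_X_zero, sub2_X_one, map_add,
      pderiv_one_X_zero, pderiv_one_X_one, zero_add, mul_one, mul_zero, add_zero]
  refine invariant_of_relation (P := fun a b => sub2 a b p)
    (Q₁ := fun a b => sub2 a b (pderiv 0 q)) (Q₂ := fun a b => sub2 a b (pderiv 1 q))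
    (e := C (ε : ℚ)) ?_ ?_ hp.sub2_neg_left hp.add_sub2_eq_zero hp.period_sub2 ?_ ?_ ?_
    hq.pderiv_add_sub2_eq_zero ?_ hq.period_pderiv_sub2 ?_ a b
  · rcases hε with rfl | rfl <;> simp
  · intro a b
    have hw1 : Even (w - 1) := by obtain ⟨k, rfl⟩ := hw; simp
    rw [hph.sub2_neg_neg, hw1.neg_one_pow, one_mul]
  · intro a b
    rw [(hqh 0).sub2_neg_neg, hw.neg_one_pow, neg_one_mul]
  · intro a b
    simpa using hq.sub2_neg_left_pderiv_zero a b
  · intro a b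
    simpa using hq.sub2_neg_left_pderiv_one a b
  · intro a b
    rw [(hqh 1).sub2_neg_neg, hw.neg_one_pow, neg_one_mul]
  · intro a b
    have := congrArg (sub2 a b) h
    simpa only [sub2_add, sub2_sub, sub2_mul, sub2_C, sub2_sub2, sub2_neg, sub2_X_zero, sub2_X_one,
      sub2_zero, hR', smul_eq_C_mul] using this

theorem stmt4 (w : ℕ) (hw : Odd w) (hpos : 0 < w) (ε : ℤ) (hε : ε = 1 ∨ ε = -1)
    (p q : MvPolynomial (Fin 2) ℚ) (hp : memW (w - 1) ε p) (hq : memW (w + 1) (-ε) q)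
    (R : MvPolynomial (Fin 2) ℚ)
    (hR : R = X 0 * sub2 (X 0 + X 1) (X 0) p + pderiv 1 (sub2 (X 0 + X 1) (X 0) q))
    (h : R + (ε : ℚ) • sub2 (X 1) (X 0) R - (ε : ℚ) • sub2 (-X 0) (X 1) R
        - sub2 (X 1) (-X 0) R = 0) :
    p = 0 ∧ ∃ c : ℚ, q = c • ((X 0 : MvPolynomial (Fin 2) ℚ) ^ (w + 1) - (X 1) ^ (w + 1)) := by
  obtain ⟨c, hc⟩ := exists_X_zero_mul_sub_pderiv_eq hw hε hp hq hR h
  have hcw : (w : ℚ) + 1 ≠ 0 := by positivity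
  have hp_par := hp.sub2_neg_left (X 0) (X 1)
  have hq_par := hq.sub2_neg_left_pderiv_one (X 0) (X 1)
  have hswap := congrArg (sub2 (X 1) (X 0)) hc
  have hflip := congrArg (sub2 (-X 0) (X 1)) hc
  simp only [sub2_sub, sub2_mul, sub2_X_zero, sub2_X_one, sub2_C, sub2_pow, sub2_X_X]
    at hswap hflip hp_par hq_par
  have hq_eq : q = C (c / (w + 1)) * (-C (ε : ℚ) * X 0 ^ (w + 1) - X 1 ^ (w + 1)) := by
    have hp_anti := hp.add_sub2_eq_zero (X 0) (X 1)
    have hp_par' := hp.sub2_neg_left (X 1) (X 0)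
    have hq_anti := hq.pderiv_add_sub2_eq_zero (X 0) (X 1)
    have hq_par' := hq.sub2_neg_left_pderiv_one (X 1) (X 0)
    have euler := hq.1.1.sum_X_mul_pderiv
    rw [Fin.sum_univ_two, nsmul_eq_mul] at euler
    simp only [sub2_X_X, Int.cast_neg, map_neg] at hp_anti hq_anti hq_par'
    push_cast at euler
    have hmul : (C ((w : ℚ) + 1) : MvPolynomial (Fin 2) ℚ) * q =
        C c * (-C (ε : ℚ) * X 0 ^ (w + 1) - X 1 ^ (w + 1)) := by
      simp only [map_add, map_natCast, map_one]
      linear_combination -euler - X 1 * hc - C (ε : ℚ) * X 0 * hswap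
        + X 0 * X 1 * (hp_anti - hp_par') + X 0 * (hq_anti - hq_par')
    refine mul_left_cancel₀ (a := C ((w : ℚ) + 1)) (C_ne_zero.mpr hcw) ?_
    rw [hmul, ← mul_assoc, ← C_mul, mul_div_cancel₀ _ hcw]
  refine ⟨?_, c / (w + 1), ?_⟩
  · have h1 : pderiv 1 q = -(C c * X 1 ^ w) := by
      rw [hq_eq]
      simp only [Derivation.leibniz, map_sub, map_neg, Derivation.leibniz_pow, pderiv_C,
        pderiv_one_X_zero, pderiv_one_X_one, smul_eq_mul, nsmul_eq_mul, Nat.add_sub_cancel,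
        mul_zero, mul_one, smul_zero, neg_zero, add_zero, zero_sub]
      have : C c = C (c / (w + 1)) * ((w + 1 : ℕ) : MvPolynomial (Fin 2) ℚ) := by
        rw [← map_natCast C, ← C_mul]
        push_cast
        rw [div_mul_cancel₀ _ hcw]
      rw [this]
      ring
    simpa [h1] using hc
  · rw [smul_eq_C_mul]
    rcases hε with rfl | rfl
    · have hc0 : c = 0 := by
        have : C (2 * c) * X 1 ^ w = (0 : MvPolynomial (Fin 2) ℚ) := by
          simp only [Int.cast_neg, Int.cast_one, map_neg, map_one] at hp_par hq_par
          rw [map_mul, map_ofNat]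
          linear_combination -hc - hflip - X 0 * hp_par - hq_par
        simpa using this
      simpa [hc0] using hq_eq
    · simpa using hq_eq
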